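/- Let f be a trigonometric polynomial on ℝ, f(x) = Σ_{j=0}^m a_j e^{ixξ_j} with ξ₀ = 0 and ξ_k ≠ 0 for k ≥ 1, and let μ^t_ε (t ≠ 0) be the probability measures with density |e^{itΔ}√(ρ_ε)|², ρ satisfying (M). Then lim_{ε→0} ∫ f dμ^t_ε = a₀ = lim_{R→∞} (1/(2R)) ∫_{−R}^R f(x) dx. -/

import Mathlib

open MeasureTheory Filter

noncomputable section

/-- One-dimensional free Schrödinger kernel. -/
def schrodingerKernel1 (t : ℝ) (x : ℝ) : ℂ :=
  Complex.exp (-((x : ℂ)) ^ 2 / (4 * Complex.I * (t : ℂ))) /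
    ((4 * (Real.pi : ℂ) * Complex.I * (t : ℂ)) ^ ((1 : ℂ) / 2))

/-- `u_ε(·,t) = e^{itΔ} √(ρ_ε)` in one dimension, `ρ_ε(x) = ε⁻¹ ρ(x/ε)`. -/
def uEps1 (ρ : ℝ → ℝ) (ε t x : ℝ) : ℂ :=
  ∫ y, schrodingerKernel1 t (x - y) * ((Real.sqrt (ε⁻¹ * ρ (y / ε)) : ℝ) : ℂ)

open FourierTransform in
lemma aux_fourier_ae (g : ℝ → ℂ) (hg : Integrable g) (hg2 : MemLp g 2) :
    ((𝓕 (hg2.toLp g) : Lp (α := ℝ) ℂ 2) : ℝ → ℂ) =ᵐ[volume] 𝓕 g := by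
  have hcont : Continuous (𝓕 g) :=
    VectorFourier.fourierIntegral_continuous Real.continuous_fourierChar
      (by exact continuous_inner) hg
  refine ae_eq_of_integral_contDiff_smul_eq ?_ hcont.locallyIntegrable ?_
  · exact (Lp.memLp _).locallyIntegrable (by norm_num)
  intro φ hφ hφs
  have hφ' : ContDiff ℝ (⊤ : ℕ∞) (fun x => (φ x : ℂ)) :=
    Complex.ofRealCLM.contDiff.comp hφ
  have hs : HasCompactSupport (fun x => (φ x : ℂ)) :=
    hφs.comp_left (g := fun r : ℝ => (r : ℂ)) (by simp)
  let Φ : SchwartzMap ℝ ℂ := hs.toSchwartzMap hφ'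
  have hΦ : ∀ x, Φ x = (φ x : ℂ) := fun x => rfl
  have h1 := congrArg (fun T => T Φ) (MeasureTheory.Lp.fourier_toTemperedDistribution_eq (hg2.toLp g))
  simp only [TemperedDistribution.fourier_apply, Lp.toTemperedDistribution_apply] at h1
  have h2 : ∫ x, (𝓕 Φ) x • (hg2.toLp g : ℝ → ℂ) x = ∫ x, (𝓕 Φ) x • g x := by
    apply integral_congr_ae
    filter_upwards [hg2.coeFn_toLp] with x hx
    rw [hx]
  have h3 : ∫ x, (𝓕 (Φ : ℝ → ℂ)) x • g x = ∫ x, Φ x • (𝓕 g) x := by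
    simpa using! VectorFourier.integral_fourierIntegral_smul_eq_flip (L := innerₗ ℝ)
      Real.continuous_fourierChar continuous_inner Φ.integrable hg
  rw [h2] at h1
  simp only [SchwartzMap.fourier_coe] at h1
  rw [h3] at h1
  simpa [hΦ] using h1.symm

open FourierTransform in
lemma aux_memLp (g : ℝ → ℂ) (hg : Integrable g) (hg2 : MemLp g 2) : MemLp (𝓕 g) 2 :=
  (memLp_congr_ae (aux_fourier_ae g hg hg2)).1 (Lp.memLp _)

open FourierTransform in
lemma aux_plancherel (g h : ℝ → ℂ) (hg : Integrable g) (hg2 : MemLp g 2)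
    (hh : Integrable h) (hh2 : MemLp h 2) :
    ∫ w, 𝓕 h w * (starRingEnd ℂ) (𝓕 g w) = ∫ y, h y * (starRingEnd ℂ) (g y) := by
  have h1 := MeasureTheory.Lp.inner_fourier_eq (hg2.toLp g) (hh2.toLp h)
  rw [L2.inner_def, L2.inner_def] at h1
  have e1 : ∫ w, 𝓕 h w * (starRingEnd ℂ) (𝓕 g w) =
      ∫ a, inner ℂ ((𝓕 (hg2.toLp g) : Lp (α := ℝ) ℂ 2 volume) a)
        ((𝓕 (hh2.toLp h) : Lp (α := ℝ) ℂ 2 volume) a) := by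
    apply integral_congr_ae
    filter_upwards [aux_fourier_ae g hg hg2, aux_fourier_ae h hh hh2] with x hx hx'
    rw [hx, hx']
    simp
  rw [e1, h1]
  apply integral_congr_ae
  filter_upwards [hg2.coeFn_toLp, hh2.coeFn_toLp] with x hx hx'
  rw [hx, hx']
  simp

open FourierTransform in
lemma aux_corr (g : ℝ → ℂ) (hg : Integrable g) (hg2 : MemLp g 2) (s : ℝ) :
    ∫ w : ℝ, Complex.exp (Complex.I * (2 * Real.pi * s * w)) * ((‖𝓕 g w‖ ^ 2 : ℝ) : ℂ)
      = ∫ y, g (y + s) * (starRingEnd ℂ) (g y) := by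
  have hs : MeasurePreserving (fun y : ℝ => y + s) volume volume :=
    measurePreserving_add_right volume s
  rw [← aux_plancherel g (fun y => g (y + s)) hg hg2 (hg.comp_add_right s)
    (hg2.comp_measurePreserving hs)]
  have hsh : 𝓕 (fun y => g (y + s)) = fun w => Real.fourierChar (w * s) • 𝓕 g w := by
    have := VectorFourier.fourierIntegral_comp_add_right Real.fourierChar volume (innerₗ ℝ) g s
    simpa using! this
  rw [hsh]
  congr 1
  ext w
  beta_reduce
  rw [Circle.smul_def, Real.fourierChar_apply, smul_eq_mul, mul_assoc (Complex.exp _) (𝓕 g w), Complex.mul_conj,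
    Complex.normSq_eq_norm_sq]
  congr 2
  push_cast
  ring

open FourierTransform in
lemma aux_int (g : ℝ → ℂ) (hg : Integrable g) (hg2 : MemLp g 2) :
    Integrable (fun w => ((‖𝓕 g w‖ ^ 2 : ℝ) : ℂ)) :=
  ((aux_memLp g hg hg2).integrable_norm_pow (p := 2) (by norm_num)).ofReal

open FourierTransform in
lemma aux_corr_tendsto (g : ℝ → ℂ) (hg : Integrable g) (hg2 : MemLp g 2) :
    Tendsto (fun s : ℝ => ∫ y, g (y + s) * (starRingEnd ℂ) (g y)) (cocompact ℝ) (nhds 0) := by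
  have h := Real.tendsto_integral_exp_smul_cocompact (fun w => ((‖𝓕 g w‖ ^ 2 : ℝ) : ℂ))
  have hn : Tendsto (fun s : ℝ => -s) (cocompact ℝ) (cocompact ℝ) :=
    (Homeomorph.neg ℝ).isClosedEmbedding.tendsto_cocompact
  refine (h.comp hn).congr fun s => ?_
  rw [← aux_corr g hg hg2]
  simp only [Function.comp]
  congr 1
  ext w
  rw [Circle.smul_def, Real.fourierChar_apply, smul_eq_mul]
  congr 2
  push_cast
  ring

lemma aux_mean (ξ : ℝ) (hξ : ξ ≠ 0) :
    Tendsto (fun R : ℝ => (1 / (2 * R) : ℂ) * ∫ x in (-R)..R, Complex.exp (Complex.I * x * ξ))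
      atTop (nhds 0) := by
  have hc : Complex.I * (ξ : ℂ) ≠ 0 := by simp [hξ]
  have h0 : Tendsto (fun R : ℝ => |ξ|⁻¹ * R⁻¹) atTop (nhds 0) := by
    simpa using tendsto_inv_atTop_zero.const_mul (|ξ|⁻¹)
  refine squeeze_zero_norm' ?_ h0
  filter_upwards [eventually_gt_atTop 0] with R hR
  have : ∫ x in (-R)..R, Complex.exp (Complex.I * x * ξ)
      = ∫ x in (-R)..R, Complex.exp ((Complex.I * ξ) * (x : ℂ)) := by
    congr 1; ext x; congr 1; ring
  rw [this, integral_exp_mul_complex hc]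
  have n1 : ∀ r : ℝ, ‖Complex.exp (Complex.I * ξ * (r : ℂ))‖ = 1 := fun r => by
    rw [Complex.norm_exp]; simp
  have n2 := norm_sub_le (Complex.exp (Complex.I * ξ * (R : ℂ))) (Complex.exp (Complex.I * ξ * ((-R : ℝ) : ℂ)))
  rw [n1, n1] at n2
  rw [norm_mul, norm_div, norm_div]
  simp only [norm_mul, norm_one, Complex.norm_I, Complex.norm_real, one_mul, Real.norm_eq_abs,
    abs_of_pos hR, Complex.norm_ofNat]
  have hx : 0 < |ξ| := abs_pos.2 hξ
  calc _ ≤ 1 / (2 * R) * ((1 + 1) / |ξ|) := by gcongr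
    _ = _ := by field_simp; norm_num

lemma aux_mean0 :
    Tendsto (fun R : ℝ => (1 / (2 * R) : ℂ) * ∫ x in (-R)..R, Complex.exp (Complex.I * x * (0 : ℝ)))
      atTop (nhds 1) := by
  refine tendsto_const_nhds.congr' ?_
  filter_upwards [eventually_gt_atTop 0] with R hR
  have : (R : ℂ) ≠ 0 := by exact_mod_cast hR.ne'
  simp
  field_simp
  norm_num

open FourierTransform in
lemma aux_norm_u (ρ : ℝ → ℝ) (ε t x : ℝ) (ht : t ≠ 0) :
    ‖uEps1 ρ ε t x‖ ^ 2 = (4 * Real.pi * |t|)⁻¹ *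
      ‖𝓕 (fun y : ℝ => Complex.exp (Complex.I * ((y ^ 2 / (4 * t) : ℝ) : ℂ)) *
        ((Real.sqrt (ε⁻¹ * ρ (y / ε)) : ℝ) : ℂ)) (x / (4 * Real.pi * t))‖ ^ 2 := by
  have ht' : (t : ℂ) ≠ 0 := by exact_mod_cast ht
  have hpi : (Real.pi : ℂ) ≠ 0 := by exact_mod_cast Real.pi_ne_zero
  set c : ℂ := (4 * (Real.pi : ℂ) * Complex.I * (t : ℂ)) ^ ((1 : ℂ) / 2) with hc
  have hcn : ‖c‖ ^ 2 = 4 * Real.pi * |t| := by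
    rw [← norm_pow, hc, ← Complex.cpow_nat_mul]
    simp [abs_of_pos Real.pi_pos]
  have hu : uEps1 ρ ε t x = Complex.exp (Complex.I * ((x ^ 2 / (4 * t) : ℝ) : ℂ)) / c *
      𝓕 (fun y : ℝ => Complex.exp (Complex.I * ((y ^ 2 / (4 * t) : ℝ) : ℂ)) *
        ((Real.sqrt (ε⁻¹ * ρ (y / ε)) : ℝ) : ℂ)) (x / (4 * Real.pi * t)) := by
    rw [Real.fourier_real_eq_integral_exp_smul, ← integral_const_mul, uEps1]
    congr 1
    ext y
    rw [schrodingerKernel1, ← hc, smul_eq_mul]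
    have : Complex.exp (-((x - y : ℝ) : ℂ) ^ 2 / (4 * Complex.I * t)) =
        Complex.exp (Complex.I * ((x ^ 2 / (4 * t) : ℝ) : ℂ)) *
        (Complex.exp (((-2 * Real.pi * y * (x / (4 * Real.pi * t)) : ℝ) : ℂ) * Complex.I) *
        Complex.exp (Complex.I * ((y ^ 2 / (4 * t) : ℝ) : ℂ))) := by
      rw [← Complex.exp_add, ← Complex.exp_add]
      congr 1
      push_cast
      field_simp
      ring_nf
      simp only [Complex.I_sq]
      ring
    rw [this]
    ring
  have n1 : ‖Complex.exp (Complex.I * ((x ^ 2 / (4 * t) : ℝ) : ℂ))‖ = 1 := by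
    rw [mul_comm]; exact Complex.norm_exp_ofReal_mul_I _
  rw [hu, norm_mul, norm_div, n1, mul_pow, div_pow, hcn]
  simp

lemma aux_g (ρ : ℝ → ℝ)
    (hρ_int : Integrable ρ) (hρ_nonneg : ∀ x, 0 ≤ ρ x)
    (hsqrt_int : Integrable (fun x => Real.sqrt (ρ x))) (t ε : ℝ) (hε : 0 < ε) :
    Integrable (fun y : ℝ => Complex.exp (Complex.I * ((y ^ 2 / (4 * t) : ℝ) : ℂ)) *
        ((Real.sqrt (ε⁻¹ * ρ (y / ε)) : ℝ) : ℂ)) ∧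
    MemLp (fun y : ℝ => Complex.exp (Complex.I * ((y ^ 2 / (4 * t) : ℝ) : ℂ)) *
        ((Real.sqrt (ε⁻¹ * ρ (y / ε)) : ℝ) : ℂ)) 2 := by
  have hi : Integrable (fun y : ℝ => Real.sqrt (ε⁻¹ * ρ (y / ε))) := by
    simp_rw [Real.sqrt_mul (inv_nonneg.2 hε.le)]
    exact (hsqrt_int.comp_div hε.ne').const_mul _
  have hcont : Continuous (fun y : ℝ => Complex.exp (Complex.I * ((y ^ 2 / (4 * t) : ℝ) : ℂ))) := by
    fun_prop
  have hn : ∀ y : ℝ, ‖Complex.exp (Complex.I * ((y ^ 2 / (4 * t) : ℝ) : ℂ))‖ = 1 := fun y => by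
    rw [mul_comm]; exact Complex.norm_exp_ofReal_mul_I _
  have h1 : Integrable (fun y : ℝ => Complex.exp (Complex.I * ((y ^ 2 / (4 * t) : ℝ) : ℂ)) *
        ((Real.sqrt (ε⁻¹ * ρ (y / ε)) : ℝ) : ℂ)) :=
    hi.ofReal.bdd_mul (c := 1) hcont.aestronglyMeasurable (ae_of_all _ fun y => (hn y).le)
  refine ⟨h1, ?_⟩
  rw [memLp_two_iff_integrable_sq_norm h1.aestronglyMeasurable]
  refine ((hρ_int.comp_div hε.ne').const_mul ε⁻¹).congr (ae_of_all _ fun y => ?_)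
  simp only [norm_mul, hn, one_mul, Complex.norm_real, Real.norm_eq_abs, sq_abs]
  rw [Real.sq_sqrt (mul_nonneg (inv_nonneg.2 hε.le) (hρ_nonneg _))]

open FourierTransform in
/-- integrability and the formula for characters -/
lemma aux_char (ρ : ℝ → ℝ)
    (hρ_int : Integrable ρ) (hρ_nonneg : ∀ x, 0 ≤ ρ x)
    (hsqrt_int : Integrable (fun x => Real.sqrt (ρ x))) (t ε : ℝ) (ht : t ≠ 0) (hε : 0 < ε)
    (ξ : ℝ) :
    Integrable (fun x : ℝ => Complex.exp (Complex.I * x * ξ) * ((‖uEps1 ρ ε t x‖ ^ 2 : ℝ) : ℂ)) ∧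
    ∫ x : ℝ, Complex.exp (Complex.I * x * ξ) * ((‖uEps1 ρ ε t x‖ ^ 2 : ℝ) : ℂ) =
     ∫ y : ℝ, (Complex.exp (Complex.I * (((y + 2 * t * ξ) ^ 2 / (4 * t) : ℝ) : ℂ)) *
        ((Real.sqrt (ε⁻¹ * ρ ((y + 2 * t * ξ) / ε)) : ℝ) : ℂ)) *
       (starRingEnd ℂ) (Complex.exp (Complex.I * ((y ^ 2 / (4 * t) : ℝ) : ℂ)) *
        ((Real.sqrt (ε⁻¹ * ρ (y / ε)) : ℝ) : ℂ)) := by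
  obtain ⟨hg, hg2⟩ := aux_g ρ hρ_int hρ_nonneg hsqrt_int t ε hε
  simp_rw [aux_norm_u ρ ε t _ ht]
  have hcor := aux_corr _ hg hg2 (2 * t * ξ)
  have hint := aux_int _ hg hg2
  rw [← hcor]
  set G := 𝓕 (fun y : ℝ => Complex.exp (Complex.I * ((y ^ 2 / (4 * t) : ℝ) : ℂ)) *
        ((Real.sqrt (ε⁻¹ * ρ (y / ε)) : ℝ) : ℂ)) with hG
  have hpt : 4 * Real.pi * t ≠ 0 := by positivity
  have hptc : (Real.pi : ℂ) ≠ 0 := by exact_mod_cast Real.pi_ne_zero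
  have htc : (t : ℂ) ≠ 0 := by exact_mod_cast ht
  let H : ℝ → ℂ := fun w => (((4 * Real.pi * |t|)⁻¹ : ℝ) : ℂ) *
    (Complex.exp (Complex.I * (2 * Real.pi * (2 * t * ξ : ℝ) * w)) * ((‖G w‖ ^ 2 : ℝ) : ℂ))
  have hfun : (fun x : ℝ => Complex.exp (Complex.I * x * ξ) *
      (((4 * Real.pi * |t|)⁻¹ * ‖G (x / (4 * Real.pi * t))‖ ^ 2 : ℝ) : ℂ)) =
      fun x => H (x / (4 * Real.pi * t)) := by
    ext x
    simp only [H]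
    have : Complex.I * (2 * Real.pi * (2 * t * ξ : ℝ) * ((x / (4 * Real.pi * t) : ℝ) : ℂ)) = Complex.I * x * ξ := by
      push_cast
      field_simp
      ring
    rw [this]
    push_cast
    ring
  have hH : Integrable H := by
    refine Integrable.const_mul ?_ _
    refine hint.bdd_mul (c := 1) (by fun_prop) (ae_of_all _ fun w => ?_)
    rw [Complex.norm_exp]; simp
  rw [hfun]
  refine ⟨hH.comp_div hpt, ?_⟩
  rw [Measure.integral_comp_div H, integral_const_mul]
  rw [Complex.real_smul, ← mul_assoc, ← Complex.ofReal_mul]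
  have : |4 * Real.pi * t| * (4 * Real.pi * |t|)⁻¹ = 1 := by
    rw [abs_mul, abs_of_pos (by positivity : 0 < 4 * Real.pi)]
    have := abs_pos.2 ht
    field_simp
  rw [this]
  simp

lemma aux_one (ρ : ℝ → ℝ)
    (hρ_int : Integrable ρ) (hρ_nonneg : ∀ x, 0 ≤ ρ x)
    (hsqrt_int : Integrable (fun x => Real.sqrt (ρ x)))
    (hρ_one : ∫ x, ρ x = 1) (t ε : ℝ) (ht : t ≠ 0) (hε : 0 < ε) :
    ∫ x : ℝ, Complex.exp (Complex.I * x * (0 : ℝ)) * ((‖uEps1 ρ ε t x‖ ^ 2 : ℝ) : ℂ) = 1 := by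
  rw [(aux_char ρ hρ_int hρ_nonneg hsqrt_int t ε ht hε 0).2]
  simp only [mul_zero, add_zero]
  have : ∀ y : ℝ, (Complex.exp (Complex.I * ((y ^ 2 / (4 * t) : ℝ) : ℂ)) *
        ((Real.sqrt (ε⁻¹ * ρ (y / ε)) : ℝ) : ℂ)) *
       (starRingEnd ℂ) (Complex.exp (Complex.I * ((y ^ 2 / (4 * t) : ℝ) : ℂ)) *
        ((Real.sqrt (ε⁻¹ * ρ (y / ε)) : ℝ) : ℂ)) = ((ε⁻¹ * ρ (y / ε) : ℝ) : ℂ) := by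
    intro y
    have hn : ‖Complex.exp (Complex.I * ((y ^ 2 / (4 * t) : ℝ) : ℂ))‖ = 1 := by
      rw [mul_comm]; exact Complex.norm_exp_ofReal_mul_I _
    rw [Complex.mul_conj, Complex.normSq_eq_norm_sq, norm_mul, hn, one_mul, Complex.norm_real,
      Real.norm_eq_abs, sq_abs, Real.sq_sqrt (mul_nonneg (inv_nonneg.2 hε.le) (hρ_nonneg _))]
  simp_rw [this]
  rw [integral_complex_ofReal, integral_const_mul, Measure.integral_comp_div ρ, hρ_one]
  simp [abs_of_pos hε, hε.ne']

lemma aux_zero (ρ : ℝ → ℝ)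
    (hρ_int : Integrable ρ) (hρ_nonneg : ∀ x, 0 ≤ ρ x)
    (hsqrt_int : Integrable (fun x => Real.sqrt (ρ x)))
    (t : ℝ) (ht : t ≠ 0) (ξ : ℝ) (hξ : ξ ≠ 0) :
    Tendsto (fun ε : ℝ => ∫ x : ℝ, Complex.exp (Complex.I * x * ξ) *
      ((‖uEps1 ρ ε t x‖ ^ 2 : ℝ) : ℂ)) (nhdsWithin 0 (Set.Ioi 0)) (nhds 0) := by
  have hsq : Integrable (fun y => ((Real.sqrt (ρ y) : ℝ) : ℂ)) := hsqrt_int.ofReal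
  have hsq2 : MemLp (fun y => ((Real.sqrt (ρ y) : ℝ) : ℂ)) 2 := by
    rw [memLp_two_iff_integrable_sq_norm hsq.aestronglyMeasurable]
    refine hρ_int.congr (ae_of_all _ fun y => ?_)
    simp [Real.sq_sqrt (hρ_nonneg y)]
  have h1 := (aux_corr_tendsto _ hsq hsq2).norm
  have h2 : Tendsto (fun ε : ℝ => (2 * t * ξ) * ε⁻¹) (nhdsWithin 0 (Set.Ioi 0)) (cocompact ℝ) := by
    have a1 : Tendsto (fun ε : ℝ => ε⁻¹) (nhdsWithin 0 (Set.Ioi 0)) (cocompact ℝ) :=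
      tendsto_inv_nhdsGT_zero.mono_right atTop_le_cocompact
    have hne : 2 * t * ξ ≠ 0 := by positivity
    exact (Homeomorph.mulLeft₀ _ hne).isClosedEmbedding.tendsto_cocompact.comp a1
  have h3 := h1.comp h2
  rw [norm_zero] at h3
  refine squeeze_zero_norm' ?_ h3
  filter_upwards [self_mem_nhdsWithin] with ε hε
  have hε : 0 < ε := hε
  rw [(aux_char ρ hρ_int hρ_nonneg hsqrt_int t ε ht hε ξ).2]
  have hn : ∀ y : ℝ, ‖Complex.exp (Complex.I * (y : ℂ))‖ = 1 := fun y => by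
    rw [mul_comm]; exact Complex.norm_exp_ofReal_mul_I _
  refine (norm_integral_le_integral_norm _).trans (le_of_eq ?_)
  simp only [norm_mul, RCLike.norm_conj, hn, one_mul, Complex.norm_real, Real.norm_eq_abs,
    abs_of_nonneg (Real.sqrt_nonneg _), Function.comp, Complex.conj_ofReal]
  simp only [← Complex.ofReal_mul]
  rw [integral_complex_ofReal, Complex.norm_real, Real.norm_eq_abs,
    abs_of_nonneg (integral_nonneg fun y => by positivity)]
  have : ∀ y : ℝ, Real.sqrt (ε⁻¹ * ρ ((y + 2 * t * ξ) / ε)) * Real.sqrt (ε⁻¹ * ρ (y / ε)) =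
      ε⁻¹ * (fun z => Real.sqrt (ρ (z + 2 * t * ξ * ε⁻¹)) * Real.sqrt (ρ z)) (y / ε) := by
    intro y
    have hi := inv_nonneg.2 hε.le
    rw [Real.sqrt_mul hi, Real.sqrt_mul hi, add_div, div_eq_mul_inv (2 * t * ξ)]
    have := Real.mul_self_sqrt hi
    linear_combination (Real.sqrt (ρ (y / ε + 2 * t * ξ * ε⁻¹)) * Real.sqrt (ρ (y / ε))) * this
  simp_rw [this]
  rw [integral_const_mul, Measure.integral_comp_div (fun z => Real.sqrt (ρ (z + 2 * t * ξ * ε⁻¹)) * Real.sqrt (ρ z))]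
  simp [abs_of_pos hε, hε.ne']

/-- for a trigonometric polynomial `f(x) = Σ aⱼ e^{ixξⱼ}` with `ξ₀ = 0`
and `ξₖ ≠ 0` for `k ≥ 1`, `∫ f dμ^t_ε → a₀`, which equals the mean of `f`. -/
theorem limit_on_trigonometric_polynomials
    (ρ : ℝ → ℝ)
    (hρ_int : Integrable ρ) (hρ_nonneg : ∀ x, 0 ≤ ρ x)
    (hsqrt_int : Integrable (fun x => Real.sqrt (ρ x)))
    (hρ_one : ∫ x, ρ x = 1)
    (t : ℝ) (ht : t ≠ 0)
    (m : ℕ) (a : Fin (m + 1) → ℂ) (ξ : Fin (m + 1) → ℝ)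
    (hξ0 : ξ 0 = 0) (hξ : ∀ k : Fin (m + 1), k ≠ 0 → ξ k ≠ 0)
    (f : ℝ → ℂ) (hf : ∀ x, f x = ∑ j, a j * Complex.exp (Complex.I * x * ξ j)) :
    Tendsto (fun ε : ℝ => ∫ x, f x * ((‖uEps1 ρ ε t x‖ ^ 2 : ℝ) : ℂ))
      (nhdsWithin 0 (Set.Ioi 0)) (nhds (a 0)) ∧
    Tendsto (fun R : ℝ => (1 / (2 * R) : ℂ) * ∫ x in (-R)..R, f x)
      atTop (nhds (a 0)) := by
  constructor
  · have hj : ∀ j, Tendsto (fun ε : ℝ => ∫ x : ℝ, Complex.exp (Complex.I * x * ξ j) *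
        ((‖uEps1 ρ ε t x‖ ^ 2 : ℝ) : ℂ)) (nhdsWithin 0 (Set.Ioi 0))
        (nhds (if j = 0 then 1 else 0)) := by
      intro j
      split_ifs with h
      · subst h
        rw [hξ0]
        refine tendsto_const_nhds.congr' ?_
        filter_upwards [self_mem_nhdsWithin] with ε hε
        exact (aux_one ρ hρ_int hρ_nonneg hsqrt_int hρ_one t ε ht hε).symm
      · exact aux_zero ρ hρ_int hρ_nonneg hsqrt_int t ht _ (hξ j h)
    have hsum := tendsto_finsetSum Finset.univ (fun j _ => (hj j).const_mul (a j))
    simp only [mul_ite, mul_one, mul_zero, Finset.sum_ite_eq', Finset.mem_univ, if_true] at hsum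
    refine hsum.congr' ?_
    filter_upwards [self_mem_nhdsWithin] with ε hε
    simp_rw [hf, Finset.sum_mul, mul_assoc (a _)]
    rw [integral_finsetSum]
    · simp_rw [integral_const_mul]
    · intro j _
      exact (aux_char ρ hρ_int hρ_nonneg hsqrt_int t ε ht hε (ξ j)).1.const_mul _
  · have hj : ∀ j, Tendsto (fun R : ℝ => (1 / (2 * R) : ℂ) *
        ∫ x in (-R)..R, Complex.exp (Complex.I * x * ξ j)) atTop
        (nhds (if j = 0 then 1 else 0)) := by
      intro j
      split_ifs with h
      · subst h
        rw [hξ0]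
        exact aux_mean0
      · exact aux_mean _ (hξ j h)
    have hsum := tendsto_finsetSum Finset.univ (fun j _ => (hj j).const_mul (a j))
    simp only [mul_ite, mul_one, mul_zero, Finset.sum_ite_eq', Finset.mem_univ, if_true] at hsum
    refine hsum.congr fun R => ?_
    simp_rw [hf]
    rw [intervalIntegral.integral_finsetSum]
    · simp_rw [intervalIntegral.integral_const_mul, Finset.mul_sum]
      refine Finset.sum_congr rfl fun j _ => ?_
      ring
    · intro j _
      exact Continuous.intervalIntegrable (by fun_prop) _ _
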